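/- Let V = ∏_{j=ℓ,…,2,1} (c₁ x^j y^j c₂)², i.e., V = v_ℓ v_ℓ ⋯ v₂ v₂ v₁ v₁ where v_j = c₁ x^j y^j c₂. Then the only accepting computation of the queue automaton on V is the one that completely matches each pair of identical subwords v_j against each other. In particular, V is a square, and in any expression of V as a square shuffle, the two copies of v_j are matched symbol-by-symbol. -/

import Mathlib

/-- `Shuffle u v w` : `w` is an interleaving of `u` and `v`
preserving the internal order of each. -/
inductive Shuffle {α : Type*} : List α → List α → List α → Prop
  | nil : Shuffle [] [] []
  | left {u v w : List α} (a : α) : Shuffle u v w → Shuffle (a :: u) v (a :: w)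
  | right {u v w : List α} (a : α) : Shuffle u v w → Shuffle u (a :: v) (a :: w)

/-- `Run Q i x P` : starting with queue `Q` (a list of pairs of an input
position and the symbol enqueued from it), with the next input symbol at
position `i` and remaining input `x`, the queue automaton can reach the
accepting configuration (empty queue, empty input), producing the list `P`
of matched pairs `(enqueue position, match position)` along the way. -/
inductive Run {α : Type*} : List (ℕ × α) → ℕ → List α → List (ℕ × ℕ) → Prop
  | done (i : ℕ) : Run [] i [] []
  | enq {Q : List (ℕ × α)} {i : ℕ} {a : α} {x : List α} {P : List (ℕ × ℕ)} :
      Run (Q ++ [(i, a)]) (i + 1) x P → Run Q i (a :: x) P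
  | deq {Q : List (ℕ × α)} {i j : ℕ} {a : α} {x : List α} {P : List (ℕ × ℕ)} :
      Run Q (i + 1) x P → Run ((j, a) :: Q) i (a :: x) ((j, i) :: P)

/-- The word `v_j = c₁ x^j y^j c₂`. -/
def vblk {α : Type*} (c₁ c₂ x y : α) (j : ℕ) : List α :=
  c₁ :: (List.replicate j x ++ List.replicate j y ++ [c₂])

/-- The word `V = v_ℓ v_ℓ ⋯ v₂ v₂ v₁ v₁`. -/
def Vword {α : Type*} (c₁ c₂ x y : α) : ℕ → List α
  | 0 => []
  | (j + 1) =>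
      vblk c₁ c₂ x y (j + 1) ++ vblk c₁ c₂ x y (j + 1) ++ Vword c₁ c₂ x y j

/-- The canonical matching on `v_ℓ v_ℓ ⋯ v₁ v₁` starting at offset `s`:
each position of the first copy of `v_j` is matched with the corresponding
position of the second copy of `v_j`. -/
def canonPairs : ℕ → ℕ → List (ℕ × ℕ)
  | _, 0 => []
  | s, (j + 1) =>
      (List.range (2 * (j + 1) + 2)).map
        (fun t => (s + t, s + (2 * (j + 1) + 2) + t)) ++
      canonPairs (s + 2 * (2 * (j + 1) + 2)) j

/-- `Accepts Q w` : the queue automaton with queue content `Q` and remaining input `w`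
can reach the accepting configuration. -/
inductive Accepts {α : Type*} : List α → List α → Prop
  | done : Accepts [] []
  | enq {Q : List α} {a : α} {w : List α} : Accepts (Q ++ [a]) w → Accepts Q (a :: w)
  | deq {Q : List α} {a : α} {w : List α} : Accepts Q w → Accepts (a :: Q) (a :: w)

/-- `Reads n z Q Q'` : the queue contents `Q` and `Q'` are related as they are after reading
`z ^ n`, with `k` symbols dequeued and `m` symbols enqueued. -/
def Reads {α : Type*} (n : ℕ) (z : α) (Q Q' : List α) : Prop :=
  ∃ k m, k + m = n ∧ Q ++ List.replicate m z = List.replicate k z ++ Q'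

theorem Run.accepts {α : Type*} {Q : List (ℕ × α)} {i : ℕ} {w : List α} {P : List (ℕ × ℕ)}
    (h : Run Q i w P) : Accepts (Q.map Prod.snd) w := by
  induction h with
  | done => exact .done
  | enq _ ih => exact .enq (by simpa using ih)
  | deq _ ih => exact .deq ih

theorem Accepts.even_count {α : Type*} [DecidableEq α] {Q w : List α} (h : Accepts Q w) (c : α) :
    Even (Q.count c + w.count c) := by
  induction h with
  | done => simp
  | enq _ ih =>
    simp only [List.count_append, List.count_cons, List.count_nil] at ih ⊢
    grind
  | deq _ ih =>
    simp only [List.count_cons] at ih ⊢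
    grind

theorem Accepts.nil_right {α : Type*} {Q : List α} (h : Accepts Q []) : Q = [] := by
  cases h; rfl

theorem Accepts.read {α : Type*} {n : ℕ} {z : α} {w Q : List α}
    (h : Accepts Q (List.replicate n z ++ w)) : ∃ Q', Reads n z Q Q' ∧ Accepts Q' w := by
  induction n generalizing Q with
  | zero => exact ⟨Q, ⟨0, 0, rfl, by simp⟩, h⟩
  | succ n ih =>
    rw [List.replicate_succ, List.cons_append] at h
    cases h with
    | enq h =>
      obtain ⟨Q', ⟨k, m, hkm, e⟩, hQ'⟩ := ih h
      exact ⟨Q', ⟨k, m + 1, by omega, by simpa [List.replicate_succ] using e⟩, hQ'⟩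
    | deq h =>
      obtain ⟨Q', ⟨k, m, hkm, e⟩, hQ'⟩ := ih h
      exact ⟨Q', ⟨k + 1, m, by omega, by simpa [List.replicate_succ] using e⟩, hQ'⟩

theorem Accepts.read_one {α : Type*} {z : α} {w Q : List α}
    (h : Accepts Q (z :: w)) : ∃ Q', Reads 1 z Q Q' ∧ Accepts Q' w :=
  Accepts.read (n := 1) h

theorem Accepts.read_vblk {α : Type*} {c₁ c₂ x y : α} {j : ℕ} {w Q : List α}
    (h : Accepts Q (vblk c₁ c₂ x y j ++ w)) :
    ∃ Q₁ Q₂ Q₃ Q₄, Reads 1 c₁ Q Q₁ ∧ Reads j x Q₁ Q₂ ∧ Reads j y Q₂ Q₃ ∧ Reads 1 c₂ Q₃ Q₄ ∧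
      Accepts Q₄ w := by
  simp only [vblk, List.cons_append, List.append_assoc, List.nil_append] at h
  obtain ⟨Q₁, r₁, h⟩ := h.read_one
  obtain ⟨Q₂, r₂, h⟩ := h.read
  obtain ⟨Q₃, r₃, h⟩ := h.read
  obtain ⟨Q₄, r₄, h⟩ := h.read_one
  exact ⟨Q₁, Q₂, Q₃, Q₄, r₁, r₂, r₃, r₄, h⟩

/-- A symbol different from the one being read, and everything behind it, stays in the queue. -/
theorem Reads.keep {α : Type*} {n : ℕ} {z b : α} {A B Q' : List α} (hb : b ≠ z)
    (h : Reads n z (A ++ b :: B) Q') :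
    ∃ k m A', k + m = n ∧ A = List.replicate k z ++ A' ∧
      Q' = A' ++ b :: B ++ List.replicate m z := by
  obtain ⟨k, m, hkm, e⟩ := h
  rw [List.append_assoc, List.append_eq_append_iff] at e
  rcases e with ⟨C, hC, e⟩ | ⟨C, hC, e⟩
  · cases C with
    | nil => exact ⟨k, m, [], hkm, by simpa using hC.symm, by simpa using e.symm⟩
    | cons d C =>
      have hd : d ∈ List.replicate k z := by rw [hC]; simp
      have := List.eq_of_mem_replicate hd
      simp only [List.cons_append, List.cons.injEq] at e
      exact absurd (e.1.trans this) hb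
  · exact ⟨k, m, C, hkm, hC, by simp [e]⟩

theorem Reads.eq_append {α : Type*} {n : ℕ} {z b : α} {B Q' : List α} (hb : b ≠ z)
    (h : Reads n z (b :: B) Q') : Q' = b :: B ++ List.replicate n z := by
  obtain ⟨k, m, A', hkm, hA, rfl⟩ := Reads.keep (A := []) hb h
  have hk : k = 0 := by
    have := congrArg List.length hA
    simp at this; omega
  subst hk
  obtain rfl : A' = [] := by simpa using hA.symm
  obtain rfl : m = n := by omega
  simp

theorem Reads.infix_of_ne {α : Type*} {n a : ℕ} {z s : α} {Q Q' : List α} (hs : s ≠ z)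
    (h : Reads n z Q Q') (hQ : List.replicate a s <:+: Q) : List.replicate a s <:+: Q' := by
  cases a with
  | zero => simp
  | succ a =>
    obtain ⟨A, B, rfl⟩ := hQ
    rw [List.replicate_succ, List.append_assoc, List.cons_append] at h
    obtain ⟨k, m, A', -, -, rfl⟩ := h.keep hs
    exact ⟨A', B ++ List.replicate m z, by simp [List.replicate_succ]⟩

/-- Reading fewer than `a` symbols `z` either preserves a run `z ^ a` or leaves a `z` in front. -/
theorem Reads.infix_or_head {α : Type*} {n a : ℕ} {z : α} {Q Q' : List α} (hn : n < a)
    (h : Reads n z Q Q') (hQ : List.replicate a z <:+: Q) :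
    List.replicate a z <:+: Q' ∨ ∃ R, Q' = z :: R := by
  obtain ⟨A, B, rfl⟩ := hQ
  obtain ⟨k, m, hkm, e⟩ := h
  rw [List.append_assoc, List.append_assoc, List.append_eq_append_iff] at e
  rcases e with ⟨C, hC, e⟩ | ⟨C, -, e⟩
  · right
    have hl : C.length < a := by
      have := congrArg List.length hC
      simp at this; omega
    have hC' : C = List.replicate C.length z :=
      List.eq_replicate_iff.2 ⟨rfl, fun b hb => by
        apply List.eq_of_mem_replicate (n := k); rw [hC]; simp [hb]⟩
    obtain ⟨t, rfl⟩ : ∃ t, a = C.length + (t + 1) := ⟨a - C.length - 1, by omega⟩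
    rw [List.replicate_add, ← hC', List.append_assoc, List.append_cancel_left_eq] at e
    exact ⟨_, by rw [← e, List.replicate_succ, List.cons_append]⟩
  · left
    exact ⟨C, B ++ List.replicate m z, by rw [e]; simp⟩

theorem Reads.head_of_lt {α : Type*} {n a : ℕ} {z : α} {B Q' : List α} (hn : n < a)
    (h : Reads n z (List.replicate a z ++ B) Q') : ∃ R, Q' = z :: R := by
  obtain ⟨k, m, hkm, e⟩ := h
  obtain ⟨t, rfl⟩ : ∃ t, a = k + (t + 1) := ⟨a - k - 1, by omega⟩
  rw [List.replicate_add, List.append_assoc, List.append_assoc, List.append_cancel_left_eq] at e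
  exact ⟨_, by rw [← e, List.replicate_succ, List.cons_append]⟩

/-- Reading a block of `z`s either preserves a run `z ^ a` that is followed by another symbol,
or consumes everything in front of that run. -/
theorem Reads.infix_or_eq {α : Type*} {n a : ℕ} {z b : α} {A B Q' : List α} (hb : b ≠ z)
    (h : Reads n z (A ++ List.replicate a z ++ b :: B) Q') :
    List.replicate a z <:+: Q' ∨
      ∃ t m, Q' = List.replicate t z ++ b :: B ++ List.replicate m z := by
  obtain ⟨k, m, A', -, e, rfl⟩ := h.keep hb
  rw [List.append_eq_append_iff] at e
  rcases e with ⟨C, -, e⟩ | ⟨C, -, e⟩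
  · right
    exact ⟨A'.length, m, by
      rw [← List.eq_replicate_iff.2 ⟨rfl, fun b hb => by
        apply List.eq_of_mem_replicate (n := a); rw [e]; simp [hb]⟩]⟩
  · left
    exact ⟨C, b :: B ++ List.replicate m z, by rw [e]; simp⟩

theorem even_count_Vword {α : Type*} [DecidableEq α] (c₁ c₂ x y c : α) (j : ℕ) :
    Even ((Vword c₁ c₂ x y j).count c) := by
  induction j with
  | zero => simp [Vword]
  | succ j ih =>
    simp only [Vword, List.count_append]
    exact Even.add ⟨_, rfl⟩ ih

theorem Accepts.even_count_queue {α : Type*} [DecidableEq α] {c₁ c₂ x y : α} {j : ℕ}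
    {Q : List α} (h : Accepts Q (Vword c₁ c₂ x y j)) (c : α) : Even (Q.count c) :=
  (Nat.even_add.1 (h.even_count c)).2 (even_count_Vword c₁ c₂ x y c j)

/-- A queue with a run `x ^ a` or `y ^ a` longer than all remaining blocks cannot be emptied. -/
def Overlong {α : Type*} (x y : α) (j : ℕ) (Q : List α) : Prop :=
  List.replicate (j + 1) x <:+: Q ∨ List.replicate (j + 1) y <:+: Q

/-- The front symbol can be matched neither by `c₁` nor by `x`, and `c₂` occurs in the queue. -/
def Blocked {α : Type*} (c₁ c₂ x : α) (Q : List α) : Prop :=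
  c₂ ∈ Q ∧ ∃ b R, Q = b :: R ∧ b ≠ c₁ ∧ b ≠ x

theorem Accepts.exists_overlong_of_blocked {α : Type*} {c₁ c₂ x y : α}
    (h₁ : c₁ ≠ c₂) (h₄ : c₂ ≠ x) (h₅ : c₂ ≠ y)
    (h₆ : x ≠ y) {j : ℕ} {Q : List α} (hQ : Blocked c₁ c₂ x Q)
    (h : Accepts Q (Vword c₁ c₂ x y (j + 1))) :
    ∃ Q', Overlong x y j Q' ∧ Accepts Q' (Vword c₁ c₂ x y j) := by
  classical
  obtain ⟨hc, b, R, hR, hb₁, hbx⟩ := hQ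
  obtain ⟨A, B, hAB⟩ := List.append_of_mem hc
  obtain ⟨C, D, hCD⟩ : ∃ C D, Q = C ++ c₂ :: D ∧ c₂ ∈ C := by
    have hev := h.even_count_queue c₂
    by_cases hA : c₂ ∈ A
    · exact ⟨A, B, hAB, hA⟩
    · have hB : c₂ ∈ B := by
        by_contra hB
        rw [hAB, List.count_append, List.count_cons_self, List.count_eq_zero.2 hA,
          List.count_eq_zero.2 hB] at hev
        simp at hev
      obtain ⟨B₁, B₂, rfl⟩ := List.append_of_mem hB
      exact ⟨A ++ c₂ :: B₁, B₂, by simp [hAB], by simp⟩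
  obtain ⟨hCD, hC⟩ := hCD
  rw [Vword, List.append_assoc] at h
  obtain ⟨Q₁, Q₂, Q₃, Q₄, r₁, r₂, r₃, r₄, h⟩ := h.read_vblk
  obtain ⟨Q₅, Q₆, Q₇, Q₈, r₅, r₆, r₇, r₈, h'⟩ := h.read_vblk
  rw [hR] at r₁
  obtain rfl := r₁.eq_append hb₁
  obtain rfl := r₂.eq_append hbx
  obtain ⟨C₁, C₂, rfl⟩ := List.append_of_mem hC
  replace r₃ : Reads (j + 1) y (C₁ ++ c₂ :: (C₂ ++ c₂ :: (D ++ [c₁] ++ List.replicate (j + 1) x)))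
      Q₃ := by
    have e : C₁ ++ c₂ :: (C₂ ++ c₂ :: (D ++ [c₁] ++ List.replicate (j + 1) x)) =
        b :: R ++ [c₁] ++ List.replicate (j + 1) x := by
      rw [← hR, hCD]; simp
    rw [e]; exact r₃
  obtain ⟨k, m, A₃, -, -, rfl⟩ := r₃.keep h₅
  have hQ₄ : ∃ A₄ E, Q₄ = A₄ ++ c₂ :: (D ++ [c₁] ++ List.replicate (j + 1) x ++ E) := by
    obtain ⟨k', m', hkm, e⟩ := r₄
    rcases Nat.eq_zero_or_pos k' with rfl | hk
    · exact ⟨A₃ ++ c₂ :: C₂, List.replicate m y ++ List.replicate m' c₂, by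
        rw [List.replicate_zero, List.nil_append] at e
        rw [← e]; simp⟩
    · obtain rfl : k' = 1 := by omega
      obtain rfl : m' = 0 := by omega
      cases A₃ with
      | nil => exact ⟨C₂, List.replicate m y, by
          simp at e
          rw [← e]; simp⟩
      | cons d A₃ => exact ⟨A₃ ++ c₂ :: C₂, List.replicate m y, by
          simp at e
          rw [← e.2]; simp⟩
  obtain ⟨A₄, E, rfl⟩ := hQ₄
  obtain ⟨-, m₅, A₅, -, -, rfl⟩ := r₅.keep h₁.symm
  rw [List.append_assoc, List.cons_append] at r₆
  obtain ⟨-, m₆, A₆, -, -, rfl⟩ := r₆.keep h₄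
  refine ⟨Q₈, Or.inl (r₈.infix_of_ne h₄.symm (r₇.infix_of_ne h₆ ?_)), h'⟩
  exact ⟨A₆ ++ c₂ :: (D ++ [c₁]), E ++ List.replicate m₅ c₁ ++ List.replicate m₆ x, by simp⟩

theorem Accepts.exists_overlong_or_blocked {α : Type*} {c₁ c₂ x y : α}
    (h₁ : c₁ ≠ c₂) (h₂ : c₁ ≠ x) (h₃ : c₁ ≠ y) (h₄ : c₂ ≠ x) (h₅ : c₂ ≠ y)
    (h₆ : x ≠ y) {j : ℕ} {Q : List α} (hQ : Overlong x y (j + 1) Q)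
    (h : Accepts Q (Vword c₁ c₂ x y (j + 1))) :
    ∃ Q', (Overlong x y j Q' ∨ Blocked c₁ c₂ x Q') ∧ Accepts Q' (Vword c₁ c₂ x y j) := by
  classical
  have hle : ∀ (z : α) {Q : List α}, List.replicate (j + 1 + 1) z <:+: Q →
      List.replicate (j + 1) z <:+: Q := fun z Q hz =>
    List.IsInfix.trans ⟨[z], [], by simp [List.replicate_succ]⟩ hz
  rw [Vword, List.append_assoc] at h
  obtain ⟨Q₁, Q₂, Q₃, Q₄, r₁, r₂, r₃, r₄, h⟩ := h.read_vblk
  obtain ⟨Q₅, Q₆, Q₇, Q₈, r₅, r₆, r₇, r₈, h'⟩ := h.read_vblk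
  refine ⟨Q₈, ?_, h'⟩
  rcases hQ with hQ | hQ
  · rcases r₂.infix_or_head (Nat.lt_succ_self _) (r₁.infix_of_ne h₂.symm hQ) with hQ | ⟨R, rfl⟩
    · have hQ₅ := r₅.infix_of_ne h₂.symm (r₄.infix_of_ne h₄.symm (r₃.infix_of_ne h₆ hQ))
      left
      rcases r₆.infix_or_head (Nat.lt_succ_self _) hQ₅ with hQ | ⟨R, rfl⟩
      · exact Or.inl (hle x (r₈.infix_of_ne h₄.symm (r₇.infix_of_ne h₆ hQ)))
      · obtain rfl := r₇.eq_append h₆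
        exact Or.inr (r₈.infix_of_ne h₅.symm (List.suffix_append _ _).isInfix)
    · obtain rfl := r₃.eq_append h₆
      obtain rfl := r₄.eq_append h₄.symm
      obtain rfl := r₅.eq_append h₂.symm
      have r₆' : Reads (j + 1) x ((x :: R) ++ y :: (List.replicate j y ++ [c₂, c₁])) Q₆ := by
        simpa [List.replicate_succ] using r₆
      obtain ⟨-, m₆, A₆, -, -, rfl⟩ := r₆'.keep h₆.symm
      have r₇' : Reads (j + 1) y
          (A₆ ++ List.replicate (j + 1) y ++ c₂ :: (c₁ :: List.replicate m₆ x)) Q₇ := by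
        simpa [List.replicate_succ] using r₇
      rcases r₇'.infix_or_eq h₅ with hQ | ⟨t, m₇, rfl⟩
      · exact Or.inl (Or.inr (r₈.infix_of_ne h₅.symm hQ))
      · cases t with
        | succ t =>
          rw [List.replicate_succ, List.cons_append, List.cons_append] at r₈
          obtain rfl := r₈.eq_append h₅.symm
          exact Or.inr ⟨by simp, _, _, rfl, h₃.symm, h₆.symm⟩
        | zero =>
          exfalso
          obtain ⟨k, m, hkm, e⟩ := r₈
          have hc := congrArg (List.count c₁) e
          simp [List.count_replicate, h₁.symm, h₂.symm, h₃.symm] at hc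
          have := h'.even_count_queue c₁
          rw [← hc] at this
          simp at this
  · have hQ₂ := r₂.infix_of_ne h₆.symm (r₁.infix_of_ne h₃.symm hQ)
    rcases r₃.infix_or_head (Nat.lt_succ_self _) hQ₂ with hQ | ⟨R, rfl⟩
    · have hQ₆ := r₆.infix_of_ne h₆.symm (r₅.infix_of_ne h₃.symm (r₄.infix_of_ne h₅.symm hQ))
      rcases r₇.infix_or_head (Nat.lt_succ_self _) hQ₆ with hQ | ⟨R, rfl⟩
      · exact Or.inl (Or.inr (hle y (r₈.infix_of_ne h₅.symm hQ)))
      · obtain rfl := r₈.eq_append h₅.symm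
        exact Or.inr ⟨by simp, _, _, rfl, h₃.symm, h₆.symm⟩
    · obtain rfl := r₄.eq_append h₅.symm
      obtain rfl := r₅.eq_append h₃.symm
      obtain rfl := r₆.eq_append h₆.symm
      exact Or.inl (Or.inl (r₈.infix_of_ne h₄.symm
        (r₇.infix_of_ne h₆ (List.suffix_append _ _).isInfix)))

theorem not_accepts_of_overlong_or_blocked {α : Type*} {c₁ c₂ x y : α}
    (h₁ : c₁ ≠ c₂) (h₂ : c₁ ≠ x) (h₃ : c₁ ≠ y) (h₄ : c₂ ≠ x) (h₅ : c₂ ≠ y)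
    (h₆ : x ≠ y) {j : ℕ} {Q : List α} (hQ : Overlong x y j Q ∨ Blocked c₁ c₂ x Q) :
    ¬ Accepts Q (Vword c₁ c₂ x y j) := by
  intro h
  induction j generalizing Q with
  | zero =>
    obtain rfl := h.nil_right
    simp [Overlong, Blocked] at hQ
  | succ j ih =>
    rcases hQ with hQ | hQ
    · obtain ⟨Q', hQ', hacc⟩ := h.exists_overlong_or_blocked h₁ h₂ h₃ h₄ h₅ h₆ hQ
      exact ih hQ' hacc
    · obtain ⟨Q', hQ', hacc⟩ := h.exists_overlong_of_blocked h₁ h₄ h₅ h₆ hQ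
      exact ih (Or.inl hQ') hacc

/-- With queue content `v` and input `v ++ w`, the automaton must match all of `v`,
since enqueuing a symbol of `v` at any stage prevents acceptance. -/
def Forced {α : Type*} (w : List α) : List α → Prop
  | [] => True
  | a :: r => ¬ Accepts (a :: r ++ [a]) (r ++ w) ∧ Forced w r

theorem forced_vblk {α : Type*} {c₁ c₂ x y : α}
    (h₁ : c₁ ≠ c₂) (h₂ : c₁ ≠ x) (h₃ : c₁ ≠ y) (h₄ : c₂ ≠ x) (h₅ : c₂ ≠ y)
    (h₆ : x ≠ y) (j : ℕ) :
    Forced (Vword c₁ c₂ x y j) (vblk c₁ c₂ x y (j + 1)) := by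
  have dead : ∀ {Q : List α}, Accepts Q (Vword c₁ c₂ x y j) →
      Overlong x y j Q ∨ Blocked c₁ c₂ x Q → False := fun h hQ =>
    not_accepts_of_overlong_or_blocked h₁ h₂ h₃ h₄ h₅ h₆ hQ h
  have hy : ∀ p, Forced (Vword c₁ c₂ x y j) (List.replicate p y ++ [c₂]) := by
    intro p
    induction p with
    | zero => exact ⟨fun h => dead h (Or.inr ⟨by simp, _, _, rfl, h₁.symm, h₄⟩), trivial⟩
    | succ p ih =>
      refine ⟨fun h => ?_, ih⟩
      change Accepts (List.replicate (p + 1) y ++ [c₂] ++ [y])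
        (List.replicate p y ++ [c₂] ++ Vword c₁ c₂ x y j) at h
      rw [List.append_assoc, List.append_assoc] at h
      obtain ⟨Q₁, r₁, h⟩ := h.read
      obtain ⟨R, rfl⟩ := r₁.head_of_lt (Nat.lt_succ_self _)
      obtain ⟨Q₂, r₂, h⟩ := h.read_one
      obtain rfl := r₂.eq_append h₅.symm
      exact dead h (Or.inr ⟨by simp, _, _, rfl, h₃.symm, h₆.symm⟩)
  have hx : ∀ p, Forced (Vword c₁ c₂ x y j)
      (List.replicate p x ++ (List.replicate (j + 1) y ++ [c₂])) := by
    intro p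
    induction p with
    | zero => exact hy _
    | succ p ih =>
      refine ⟨fun h => ?_, ih⟩
      change Accepts (List.replicate (p + 1) x ++ (List.replicate (j + 1) y ++ [c₂]) ++ [x])
        (List.replicate p x ++ (List.replicate (j + 1) y ++ [c₂]) ++ Vword c₁ c₂ x y j) at h
      rw [List.append_assoc, List.append_assoc (List.replicate p x),
        List.append_assoc (List.replicate (j + 1) y) [c₂] (Vword c₁ c₂ x y j)] at h
      obtain ⟨Q₁, r₁, h⟩ := h.read
      obtain ⟨R, rfl⟩ := r₁.head_of_lt (Nat.lt_succ_self _)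
      obtain ⟨Q₂, r₂, h⟩ := h.read
      obtain rfl := r₂.eq_append h₆
      obtain ⟨Q₃, r₃, h⟩ := h.read_one
      exact dead h (Or.inl (Or.inr (r₃.infix_of_ne h₅.symm (List.suffix_append _ _).isInfix)))
  rw [vblk, List.append_assoc]
  refine ⟨fun h => ?_, hx _⟩
  rw [List.append_assoc _ _ (Vword c₁ c₂ x y j), List.append_assoc _ [c₂], List.cons_append] at h
  obtain ⟨Q₁, r₁, h⟩ := h.read
  obtain rfl := r₁.eq_append h₂
  obtain ⟨Q₂, r₂, h⟩ := h.read
  obtain ⟨Q₃, r₃, h⟩ := h.read_one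
  exact dead h (Or.inl (Or.inl (r₃.infix_of_ne h₄.symm
    (r₂.infix_of_ne h₆ (List.suffix_append _ _).isInfix))))

/-- The symbols of a word, labelled by consecutive positions starting at `s`. -/
def labelled {α : Type*} : ℕ → List α → List (ℕ × α)
  | _, [] => []
  | s, a :: v => (s, a) :: labelled (s + 1) v

theorem map_snd_labelled {α : Type*} (s : ℕ) (v : List α) :
    (labelled s v).map Prod.snd = v := by
  induction v generalizing s with
  | nil => rfl
  | cons a v ih => simp [labelled, ih]

theorem Run.enqueue_of_ne {α : Type*} {q : ℕ × α} {Q : List (ℕ × α)} {i : ℕ} {v w : List α}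
    {P : List (ℕ × ℕ)} (hv : ∀ a ∈ v, a ≠ q.2) (h : Run (q :: Q) i (v ++ w) P) :
    Run (q :: Q ++ labelled i v) (i + v.length) w P := by
  induction v generalizing Q i with
  | nil => simpa [labelled] using h
  | cons a v ih =>
    rw [List.cons_append] at h
    cases h with
    | enq h =>
      have := ih (fun b hb => hv b (List.mem_cons_of_mem _ hb)) h
      simpa [labelled, Nat.add_assoc, Nat.add_comm 1] using this
    | deq h => exact absurd rfl (hv _ List.mem_cons_self)

theorem Run.match_of_forced {α : Type*} {v w : List α} (hv : Forced w v) {s i : ℕ}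
    {P : List (ℕ × ℕ)} (h : Run (labelled s v) i (v ++ w) P) :
    ∃ P', P = (List.range v.length).map (fun t => (s + t, i + t)) ++ P' ∧
      Run [] (i + v.length) w P' := by
  induction v generalizing s i P with
  | nil => exact ⟨P, by simp, h⟩
  | cons a v ih =>
    rw [labelled, List.cons_append] at h
    cases h with
    | enq h =>
      have := h.accepts
      simp only [List.map_append, List.map_cons, map_snd_labelled, List.map_nil] at this
      exact absurd this hv.1
    | deq h =>
      obtain ⟨P', rfl, h'⟩ := ih hv.2 h
      refine ⟨P', ?_, ?_⟩
      · simp [List.range_succ_eq_map, Function.comp_def, Nat.add_assoc, Nat.add_comm 1]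
      · simpa [Nat.add_assoc, Nat.add_comm 1] using h'

theorem length_vblk {α : Type*} (c₁ c₂ x y : α) (j : ℕ) :
    (vblk c₁ c₂ x y j).length = 2 * j + 2 := by
  simp [vblk]; omega

theorem Run.eq_canonPairs {α : Type*} {c₁ c₂ x y : α}
    (h₁ : c₁ ≠ c₂) (h₂ : c₁ ≠ x) (h₃ : c₁ ≠ y) (h₄ : c₂ ≠ x) (h₅ : c₂ ≠ y)
    (h₆ : x ≠ y) {j s : ℕ} {P : List (ℕ × ℕ)}
    (h : Run ([] : List (ℕ × α)) s (Vword c₁ c₂ x y j) P) : P = canonPairs s j := by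
  induction j generalizing s P with
  | zero => cases h; rfl
  | succ j ih =>
    rw [Vword, List.append_assoc] at h
    have hfirst : Run (labelled s (vblk c₁ c₂ x y (j + 1)))
        (s + (vblk c₁ c₂ x y (j + 1)).length)
        (vblk c₁ c₂ x y (j + 1) ++ Vword c₁ c₂ x y j) P := by
      generalize hw : vblk c₁ c₂ x y (j + 1) ++ Vword c₁ c₂ x y j = w at h
      rw [vblk, List.cons_append] at h
      cases h with
      | enq h =>
        have := Run.enqueue_of_ne (Q := []) (fun a ha => by
          simp only [List.mem_append, List.mem_replicate, List.mem_singleton] at ha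
          rcases ha with (⟨-, rfl⟩ | ⟨-, rfl⟩) | rfl
          exacts [h₂.symm, h₃.symm, h₁.symm]) h
        rw [vblk, List.length_cons, ← Nat.add_assoc, Nat.add_right_comm]
        exact this
    obtain ⟨P', rfl, h'⟩ := hfirst.match_of_forced (forced_vblk h₁ h₂ h₃ h₄ h₅ h₆ j)
    rw [ih h', length_vblk, canonPairs]
    congr 2
    omega

theorem Shuffle.append {α : Type*} {u v w u' v' w' : List α} (h : Shuffle u v w)
    (h' : Shuffle u' v' w') : Shuffle (u ++ u') (v ++ v') (w ++ w') := by
  induction h with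
  | nil => exact h'
  | left a _ ih => exact .left a ih
  | right a _ ih => exact .right a ih

theorem Shuffle.nil_right {α : Type*} (v : List α) : Shuffle v [] v := by
  induction v with
  | nil => exact .nil
  | cons a v ih => exact .left a ih

theorem Shuffle.nil_left {α : Type*} (v : List α) : Shuffle [] v v := by
  induction v with
  | nil => exact .nil
  | cons a v ih => exact .right a ih

theorem exists_shuffle_Vword {α : Type*} (c₁ c₂ x y : α) (j : ℕ) :
    ∃ u : List α, Shuffle u u (Vword c₁ c₂ x y j) := by
  induction j with
  | zero => exact ⟨[], .nil⟩
  | succ j ih =>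
    obtain ⟨u, hu⟩ := ih
    have hv := (Shuffle.nil_right (vblk c₁ c₂ x y (j + 1))).append 
      (Shuffle.nil_left (vblk c₁ c₂ x y (j + 1)))
    exact ⟨vblk c₁ c₂ x y (j + 1) ++ u, by simpa [Vword] using hv.append hu⟩

/-- the only accepting computation of the queue automaton on
`V = ∏_{j=ℓ,…,1} (c₁ x^j y^j c₂)²` matches each pair of identical subwords
`v_j` symbol-by-symbol against each other.  In particular `V` is a square. -/
theorem V_unique_accepting_computation {α : Type*} (c₁ c₂ x y : α)
    (h₁ : c₁ ≠ c₂) (h₂ : c₁ ≠ x) (h₃ : c₁ ≠ y) (h₄ : c₂ ≠ x) (h₅ : c₂ ≠ y)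
    (h₆ : x ≠ y) (ℓ : ℕ) :
    (∃ u : List α, Shuffle u u (Vword c₁ c₂ x y ℓ)) ∧
      ∀ P : List (ℕ × ℕ),
        Run ([] : List (ℕ × α)) 0 (Vword c₁ c₂ x y ℓ) P →
        ∀ pr : ℕ × ℕ, pr ∈ P ↔ pr ∈ canonPairs 0 ℓ := by
  refine ⟨exists_shuffle_Vword c₁ c₂ x y ℓ, fun P h pr => ?_⟩
  rw [h.eq_canonPairs h₁ h₂ h₃ h₄ h₅ h₆]
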